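/- Assume (H1), (H2), and (H3), and that s ↦ f(s,z_s) is Lebesgue integrable on [0,τ]. Then for every bounded z : [−r,τ] → ℝⁿ with sup_{t∈[−r,τ]} ‖z(t) − φ̃(t)‖ ≤ ρ, the function F(z, J(z)) also satisfies sup_{t∈[−r,τ]} ‖F(z,J(z))(t) − φ̃(t)‖ ≤ ρ; that is, the set D_ρ = {z : ‖z − φ̃‖ ≤ ρ} is invariant under the map z ↦ F(z, J(z)). -/

import Mathlib

open Matrix MeasureTheory Set Filter

/-- supremum of the norm of `w` over the interval `[a, b]`. -/
noncomputable def supOn {E : Type*} [NormedAddCommGroup E]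
    (a b : ℝ) (w : ℝ → E) : ℝ :=
  ⨆ u : Set.Icc a b, ‖w u.1‖

/-- `w` is bounded (in norm) on the interval `[a, b]`. -/
def BddOn {E : Type*} [NormedAddCommGroup E] (a b : ℝ) (w : ℝ → E) : Prop :=
  ∃ C : ℝ, ∀ u ∈ Set.Icc a b, ‖w u‖ ≤ C

theorem norm_le_supOn {E : Type*} [NormedAddCommGroup E] {a b : ℝ} {w : ℝ → E}
    (hw : BddOn a b w) {u : ℝ} (hu : u ∈ Set.Icc a b) : ‖w u‖ ≤ supOn a b w := by
  obtain ⟨C, hC⟩ := hw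
  exact le_ciSup (f := fun v : Set.Icc a b => ‖w v.1‖)
    ⟨C, by rintro _ ⟨v, rfl⟩; exact hC v.1 v.2⟩ ⟨u, hu⟩

theorem supOn_le {E : Type*} [NormedAddCommGroup E] {a b C : ℝ} {w : ℝ → E}
    (hab : a ≤ b) (hw : ∀ u ∈ Set.Icc a b, ‖w u‖ ≤ C) : supOn a b w ≤ C := by
  have : Nonempty (Set.Icc a b) := ⟨⟨a, le_rfl, hab⟩⟩
  exact ciSup_le fun v => hw v.1 v.2

theorem BddOn.of_norm_sub_le {E : Type*} [NormedAddCommGroup E] {a b C : ℝ} {v w : ℝ → E}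
    (hv : BddOn a b v) (h : ∀ u ∈ Set.Icc a b, ‖v u - w u‖ ≤ C) : BddOn a b w := by
  obtain ⟨B, hB⟩ := hv
  refine ⟨B + C, fun u hu => ?_⟩
  calc ‖w u‖ = ‖v u - (v u - w u)‖ := by rw [sub_sub_cancel]
    _ ≤ B + C := (norm_sub_le _ _).trans (add_le_add (hB u hu) (h u hu))

/-- A point of `(t 0, t k]` lies in one of the intervals `(s i, t (i + 1)]` or `(t i, s i]`. -/
theorem exists_mem_Ioc_of_mem_Ioc (t s : ℕ → ℝ) {k : ℕ} {u : ℝ}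
    (hu : u ∈ Set.Ioc (t 0) (t k)) :
    ∃ i < k, u ∈ Set.Ioc (s i) (t (i + 1)) ∨ u ∈ Set.Ioc (t i) (s i) := by
  induction k with
  | zero => exact absurd hu.1 (not_lt.2 hu.2)
  | succ k ih =>
    rcases le_or_gt u (t k) with h | h
    · obtain ⟨i, hi, h'⟩ := ih ⟨hu.1, h⟩
      exact ⟨i, hi.trans k.lt_succ_self, h'⟩
    · rcases le_or_gt u (s k) with h' | h'
      · exact ⟨k, k.lt_succ_self, Or.inr ⟨h, h'⟩⟩
      · exact ⟨k, k.lt_succ_self, Or.inl ⟨h', hu.2⟩⟩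

/-- Under (H1), (H2) and (H3), the closed ball `D_ρ = {z : ‖z − φ̃‖ ≤ ρ}` is
invariant under the map `z ↦ F(z, J(z))`. -/
theorem D_rho_invariant
    (n N q : ℕ) (hn : 1 ≤ n)
    (r τ : ℝ) (hr : 0 < r) (hτ : 0 < τ)
    (tt ss : ℕ → ℝ) (htt0 : tt 0 = 0) (hss0 : ss 0 = 0) (htt1 : 0 < tt 1)
    (hts : ∀ i ∈ Finset.Icc 1 N, tt i ≤ ss i ∧ ss i < tt (i + 1))
    (httN : tt (N + 1) = τ)
    (θ : ℕ → ℝ) (hθ : ∀ j ∈ Finset.Icc 1 q, 0 < θ j ∧ θ j < τ)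
    (hθmono : ∀ j ∈ Finset.Icc 1 (q - 1), θ j < θ (j + 1))
    (A : ℝ → Matrix (Fin n) (Fin n) ℝ) (hA : Continuous A)
    (Φ : ℝ → Matrix (Fin n) (Fin n) ℝ)
    (hΦderiv : ∀ t : ℝ, ∀ i j : Fin n,
      HasDerivAt (fun u => Φ u i j) ((A t * Φ t) i j) t)
    (hΦ0 : Φ 0 = 1) (hΦinv : ∀ t, IsUnit (Φ t))
    (U : ℝ → ℝ → Matrix (Fin n) (Fin n) ℝ)
    (hU : ∀ t s : ℝ, U t s = Φ t * (Φ s)⁻¹)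
    (M : ℝ) (hM : 1 ≤ M)
    (hUbd : ∀ t s : ℝ, 0 ≤ s → s ≤ t → t ≤ τ →
      ∀ x : Fin n → ℝ, ‖U t s *ᵥ x‖ ≤ M * ‖x‖)
    -- (H1)
    (Nq L : ℝ) (hNq : 0 < Nq) (hL : 0 < L) (hNqL : L + Nq * (q : ℝ) < 1 / 2)
    (g : (Fin q → ℝ → (Fin n → ℝ)) → ℝ → (Fin n → ℝ))
    (hg0 : g (fun _ _ => 0) = fun _ => 0)
    (hglip : ∀ y z : Fin q → ℝ → (Fin n → ℝ), ∀ u ∈ Set.Icc (-r) (0 : ℝ),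
      ‖g y u - g z u‖ ≤ Nq * ∑ j : Fin q, ‖y j u - z j u‖)
    (G : ℕ → ℝ → (Fin n → ℝ) → (Fin n → ℝ))
    (hG0 : ∀ i ∈ Finset.Icc 1 N, ∀ u : ℝ, G i u 0 = 0)
    (hGlip : ∀ i ∈ Finset.Icc 1 N, ∀ (u : ℝ) (x y : Fin n → ℝ),
      ‖G i u x - G i u y‖ ≤ L * ‖x - y‖)
    -- (H2)
    (f : ℝ → (ℝ → (Fin n → ℝ)) → (Fin n → ℝ))
    (K : ℝ → ℝ → ℝ) (Ψ : ℝ → ℝ)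
    (hKcont : Continuous fun p : ℝ × ℝ => K p.1 p.2)
    (hKmono : ∀ a a' b b' : ℝ, a ≤ a' → b ≤ b' → K a b ≤ K a' b')
    (hKnonneg : ∀ a b : ℝ, 0 ≤ K a b)
    (hΨcont : Continuous Ψ) (hΨmono : Monotone Ψ) (hΨnonneg : ∀ a : ℝ, 0 ≤ Ψ a)
    (hflip : ∀ u ∈ Set.Icc (0 : ℝ) τ, ∀ φ₁ φ₂ : ℝ → (Fin n → ℝ),
      BddOn (-r) 0 φ₁ → BddOn (-r) 0 φ₂ →
      ‖f u φ₁ - f u φ₂‖ ≤ K (supOn (-r) 0 φ₁) (supOn (-r) 0 φ₂) * supOn (-r) 0 (φ₁ - φ₂))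
    (hfbd : ∀ u ∈ Set.Icc (0 : ℝ) τ, ∀ φ' : ℝ → (Fin n → ℝ),
      BddOn (-r) 0 φ' → ‖f u φ'‖ ≤ Ψ (supOn (-r) 0 φ'))
    -- data: history φ, value η, and the vectors α, β of φ̃
    (φ : ℝ → (Fin n → ℝ)) (hφ : BddOn (-r) 0 φ) (η α β : Fin n → ℝ)
    (ρ : ℝ) (hρ : 0 < ρ)
    -- φ̃, characterized by its defining piecewise equations
    (φt : ℝ → (Fin n → ℝ))
    (hφt1 : ∀ u ∈ Set.Ioc (0 : ℝ) (tt 1), φt u = U u 0 *ᵥ φ 0)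
    (hφt2 : ∀ i ∈ Finset.Icc 1 N, ∀ u ∈ Set.Ioc (ss i) (tt (i + 1)), φt u = α)
    (hφt3 : ∀ i ∈ Finset.Icc 1 N, ∀ u ∈ Set.Ioc (tt i) (ss i), φt u = β)
    (hφt4 : ∀ u ∈ Set.Icc (-r) (0 : ℝ), φt u = φ u)
    -- (H3)
    (h3i : M * Nq * (q : ℝ) * (supOn (-r) τ φt + ρ)
        + M * τ * Ψ (supOn (-r) τ φt + ρ) ≤ ρ)
    (h3ii : M * L * (supOn (-r) τ φt + ρ) + ‖α‖
        + M * τ * Ψ (supOn (-r) τ φt + ρ) ≤ ρ)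
    (h3iii : L * (supOn (-r) τ φt + ρ) + ‖β‖ ≤ ρ)
    -- the input: a bounded z ∈ D_ρ with integrable superposition
    (z : ℝ → (Fin n → ℝ)) (hz : BddOn (-r) τ z)
    (hzρ : ∀ u ∈ Set.Icc (-r) τ, ‖z u - φt u‖ ≤ ρ)
    (hfz : IntervalIntegrable (fun u => f u (fun v => z (u + v))) volume 0 τ)
    -- J(z), characterized by the defining piecewise equations
    (Jz : ℝ → (Fin n → ℝ))
    (hJz1 : ∀ u ∈ Set.Ioc (0 : ℝ) (tt 1), Jz u =
      U u 0 *ᵥ (φ 0 - g (fun j w => z (θ (j.1 + 1) + w)) 0)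
        + ∫ v in (0 : ℝ)..u, U u v *ᵥ f v (fun w => z (v + w)))
    (hJz2 : ∀ i ∈ Finset.Icc 1 N, ∀ u ∈ Set.Ioc (ss i) (tt (i + 1)), Jz u =
      U u (ss i) *ᵥ G i (ss i) (z (ss i))
        + ∫ v in (ss i)..u, U u v *ᵥ f v (fun w => z (v + w)))
    (hJz3 : ∀ i ∈ Finset.Icc 1 N, ∀ u ∈ Set.Ioc (tt i) (ss i), Jz u = η)
    (hJz4 : ∀ u ∈ Set.Icc (-r) (0 : ℝ), Jz u = φ u)
    -- w = F(z, J(z)), characterized by the defining piecewise equations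
    (w : ℝ → (Fin n → ℝ))
    (hw1 : ∀ i ∈ Finset.Icc 0 N, ∀ u ∈ Set.Ioc (ss i) (tt (i + 1)), w u = Jz u)
    (hw2 : ∀ i ∈ Finset.Icc 1 N, ∀ u ∈ Set.Ioc (tt i) (ss i), w u = G i u (z u))
    (hw3 : ∀ u ∈ Set.Icc (-r) (0 : ℝ),
      w u = φ u - g (fun j w' => z (θ (j.1 + 1) + w')) u) :
    ∀ u ∈ Set.Icc (-r) τ, ‖w u - φt u‖ ≤ ρ := by
  have htmono : MonotoneOn tt (Set.Icc 0 (N + 1)) := by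
    refine monotoneOn_of_le_succ Set.ordConnected_Icc fun i _ _ hi => ?_
    rcases Nat.eq_zero_or_pos i with rfl | hpos
    · simpa [htt0] using htt1.le
    · have h := hts i (Finset.mem_Icc.2 ⟨hpos, Nat.le_of_succ_le_succ hi.2⟩)
      exact h.1.trans h.2.le
  have htnonneg : ∀ i ≤ N + 1, 0 ≤ tt i := fun i hi =>
    htt0 ▸ htmono ⟨le_rfl, Nat.zero_le _⟩ ⟨Nat.zero_le _, hi⟩ (Nat.zero_le _)
  have htle : ∀ i ≤ N + 1, tt i ≤ τ := fun i hi =>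
    httN ▸ htmono ⟨Nat.zero_le _, hi⟩ ⟨Nat.zero_le _, le_rfl⟩ hi
  have hφtbdd : BddOn (-r) τ φt := hz.of_norm_sub_le hzρ
  set S := supOn (-r) τ φt + ρ
  have hzS : ∀ u ∈ Set.Icc (-r) τ, ‖z u‖ ≤ S := fun u hu =>
    calc ‖z u‖ = ‖φt u + (z u - φt u)‖ := by rw [add_sub_cancel]
      _ ≤ S := (norm_add_le _ _).trans (add_le_add (norm_le_supOn hφtbdd hu) (hzρ u hu))
  have hS0 : 0 ≤ S := (norm_nonneg _).trans (hzS 0 ⟨by linarith, hτ.le⟩)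
  have hM0 : 0 ≤ M := by linarith
  have hg : ∀ u ∈ Set.Icc (-r) (0 : ℝ),
      ‖g (fun j v => z (θ (j.1 + 1) + v)) u‖ ≤ Nq * (q : ℝ) * S := by
    intro u hu
    have h := hglip (fun j v => z (θ (j.1 + 1) + v)) (fun _ _ => 0) u hu
    simp only [hg0, sub_zero] at h
    refine h.trans ?_
    rw [mul_assoc]
    gcongr
    calc ∑ j : Fin q, ‖z (θ (j.1 + 1) + u)‖ ≤ ∑ _j : Fin q, S := by
          refine Finset.sum_le_sum fun j _ => hzS _ ?_
          have hj := hθ (j.1 + 1) (Finset.mem_Icc.2 ⟨by omega, j.2⟩)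
          exact ⟨by linarith [hu.1], by linarith [hu.2]⟩
      _ = q * S := by simp
  have hG : ∀ i ∈ Finset.Icc 1 N, ∀ v, ∀ u ∈ Set.Icc (-r) τ, ‖G i v (z u)‖ ≤ L * S := by
    intro i hi v u hu
    have h := hGlip i hi v (z u) 0
    rw [hG0 i hi, sub_zero, sub_zero] at h
    exact h.trans (mul_le_mul_of_nonneg_left (hzS u hu) hL.le)
  have hf : ∀ v ∈ Set.Icc (0 : ℝ) τ, ‖f v (fun x => z (v + x))‖ ≤ Ψ S := by
    intro v hv
    have hb : ∀ x ∈ Set.Icc (-r) (0 : ℝ), ‖z (v + x)‖ ≤ S := fun x hx =>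
      hzS _ ⟨by linarith [hx.1, hv.1], by linarith [hx.2, hv.2]⟩
    exact (hfbd v hv _ ⟨S, hb⟩).trans (hΨmono (supOn_le (by linarith) hb))
  have hint : ∀ s u : ℝ, 0 ≤ s → s ≤ u → u ≤ τ →
      ‖∫ v in s..u, U u v *ᵥ f v (fun x => z (v + x))‖ ≤ M * τ * Ψ S := by
    intro s u hs hsu huτ
    have h : ‖∫ v in s..u, U u v *ᵥ f v (fun x => z (v + x))‖ ≤ M * Ψ S * |u - s| := by
      refine intervalIntegral.norm_integral_le_of_norm_le_const fun v hv => ?_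
      rw [Set.uIoc_of_le hsu] at hv
      have hv0 : 0 ≤ v := hs.trans hv.1.le
      exact (hUbd u v hv0 hv.2 huτ _).trans
        (mul_le_mul_of_nonneg_left (hf v ⟨hv0, hv.2.trans huτ⟩) hM0)
    rw [abs_of_nonneg (sub_nonneg.2 hsu)] at h
    have hMΨ : 0 ≤ M * Ψ S := mul_nonneg hM0 (hΨnonneg S)
    calc _ ≤ M * Ψ S * (u - s) := h
      _ ≤ M * Ψ S * τ := mul_le_mul_of_nonneg_left (by linarith) hMΨ
      _ = M * τ * Ψ S := by ring
  intro u hu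
  rcases le_or_gt u 0 with hu0 | hu0
  · have hur : u ∈ Set.Icc (-r) (0 : ℝ) := ⟨hu.1, hu0⟩
    rw [hw3 u hur, hφt4 u hur, sub_sub_cancel_left, norm_neg]
    have hNS : 0 ≤ Nq * (q : ℝ) * S := by positivity
    have hMΨ : 0 ≤ M * τ * Ψ S := mul_nonneg (by positivity) (hΨnonneg S)
    calc _ ≤ Nq * (q : ℝ) * S := hg u hur
      _ ≤ M * (Nq * (q : ℝ) * S) := le_mul_of_one_le_left hNS hM
      _ = M * Nq * (q : ℝ) * S := by ring
      _ ≤ ρ := by linarith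
  obtain ⟨i, hiN, hi⟩ := exists_mem_Ioc_of_mem_Ioc tt ss (k := N + 1) (u := u)
    ⟨htt0.symm ▸ hu0, httN.symm ▸ hu.2⟩
  have hiN' : i ≤ N := Nat.lt_succ_iff.1 hiN
  rcases Nat.eq_zero_or_pos i with rfl | hpos
  · have hu1 : u ∈ Set.Ioc (0 : ℝ) (tt 1) := by
      rcases hi with hi | hi
      · exact ⟨hu0, hi.2⟩
      · exact absurd hu0 (not_lt.2 (hss0 ▸ hi.2))
    rw [hw1 0 (Finset.mem_Icc.2 ⟨le_rfl, Nat.zero_le N⟩) u (by rwa [hss0]), hJz1 u hu1,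
      hφt1 u hu1, Matrix.mulVec_sub, add_sub_right_comm, sub_sub_cancel_left]
    refine (norm_add_le _ _).trans (le_trans (add_le_add ?_ (hint 0 u le_rfl hu0.le hu.2)) h3i)
    rw [norm_neg, mul_assoc M, mul_assoc M]
    exact (hUbd u 0 le_rfl hu0.le hu.2 _).trans
      (mul_le_mul_of_nonneg_left (hg 0 ⟨by linarith, le_rfl⟩) hM0)
  have hi1 : i ∈ Finset.Icc 1 N := Finset.mem_Icc.2 ⟨hpos, hiN'⟩
  rcases hi with hi | hi
  · have hsi : 0 ≤ ss i := (htnonneg i hiN.le).trans (hts i hi1).1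
    have hsτ : ss i ≤ τ := hi.1.le.trans hu.2
    rw [hw1 i (Finset.mem_Icc.2 ⟨Nat.zero_le i, hiN'⟩) u hi, hJz2 i hi1 u hi, hφt2 i hi1 u hi]
    have hUG : ‖U u (ss i) *ᵥ G i (ss i) (z (ss i))‖ ≤ M * L * S := by
      rw [mul_assoc]
      exact (hUbd u (ss i) hsi hi.1.le hu.2 _).trans
        (mul_le_mul_of_nonneg_left (hG i hi1 _ _ ⟨by linarith, hsτ⟩) hM0)
    refine (norm_sub_le _ _).trans ?_
    linarith [norm_add_le (U u (ss i) *ᵥ G i (ss i) (z (ss i)))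
      (∫ v in (ss i)..u, U u v *ᵥ f v (fun x => z (v + x))), hint (ss i) u hsi hi.1.le hu.2]
  · rw [hw2 i hi1 u hi, hφt3 i hi1 u hi]
    exact (norm_sub_le _ _).trans
      ((add_le_add (hG i hi1 u u hu) le_rfl).trans h3iii)
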